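/- arXiv:1905.00853 — 2 statements merged into one kernel-verified Lean document; each statement's English description precedes it below -/
import Mathlib

section
/- In the specific 3-buyer second-price auction with interdependent valuations given by v 1 1 = 2, v 1 2 = 1, v 1 3 = 0; v 2 1 = 0, v 2 2 = 4, v 2 3 = 1; v 3 1 = 0, v 3 2 = 1, v 3 3 = 6 (ties broken in favor of the lowest-index buyer), no strategy of Buyer 1 survives the iterative deletion of weakly dominated strategies: for every bid b ∈ [0,∞) of Buyer 1 there exists a valid sequence of iterative deletions of weakly dominated strategies and a step τ of it with b ∉ S_1^τ. -/
/-- The winner of the auction: among the buyers with maximal bid, the winner is the one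
with the lowest index. -/
noncomputable def winnerLow {n : ℕ} (b : Fin (n + 1) → ℝ) : Fin (n + 1) :=
  (Finset.univ.filter fun i => ∀ j, b j ≤ b i).min' (by
    obtain ⟨i, -, hi⟩ := Finset.exists_max_image (Finset.univ : Finset (Fin (n + 1))) b
      ⟨0, Finset.mem_univ 0⟩
    exact ⟨i, Finset.mem_filter.mpr ⟨Finset.mem_univ i, fun j => hi j (Finset.mem_univ j)⟩⟩)

/-- The maximum bid among the buyers other than `w`. -/
noncomputable def secondPrice {n : ℕ} (b : Fin (n + 1) → ℝ) (w : Fin (n + 1)) : ℝ :=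
  if h : (Finset.univ.erase w).Nonempty then (Finset.univ.erase w).sup' h b else 0

/-- Buyer `i`'s utility in the second-price auction with interdependent valuations `v`:
if `i` wins it gets `v i i` minus the maximum bid of the other buyers, and if `j ≠ i`
wins then buyer `i` gets `v i j`. -/
noncomputable def utilSP {n : ℕ} (v : Fin (n + 1) → Fin (n + 1) → ℝ) (i : Fin (n + 1))
    (b : Fin (n + 1) → ℝ) : ℝ :=
  if i = winnerLow b then v i (winnerLow b) - secondPrice b (winnerLow b)
  else v i (winnerLow b)

/-- `s'` weakly dominates `s` for buyer `i` (with utility `u`) relative to the strategy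
sets `S j` of the opponents `j ≠ i`. -/
def WeaklyDominates {n : ℕ} (u : (Fin (n + 1) → ℝ) → ℝ) (i : Fin (n + 1))
    (S : Fin (n + 1) → Set ℝ) (s' s : ℝ) : Prop :=
  (∀ b : Fin (n + 1) → ℝ, (∀ j, j ≠ i → b j ∈ S j) →
    u (Function.update b i s) ≤ u (Function.update b i s')) ∧
  (∃ b : Fin (n + 1) → ℝ, (∀ j, j ≠ i → b j ∈ S j) ∧
    u (Function.update b i s) < u (Function.update b i s'))


/-- The specific interdependent valuations: buyers `0, 1, 2` stand for Buyers `1, 2, 3`;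
`v 0 = (2, 1, 0)`, `v 1 = (0, 4, 1)`, `v 2 = (0, 1, 6)`. -/
noncomputable def vA : Fin 3 → Fin 3 → ℝ := ![![2, 1, 0], ![0, 4, 1], ![0, 1, 6]]

/-- `ValidSeq v L S` : `S 0, S 1, …, S L` is a valid sequence for the iterative deletion
of weakly dominated strategies: every buyer starts with strategy set `[0, ∞)` and at each
step `1 ≤ τ ≤ L` one buyer `i` has its strategy set strictly shrunk (all other buyers'
sets are unchanged), where every deleted bid is weakly dominated, relative to the current
sets of the others, by some surviving bid. -/
def ValidSeq (v : Fin 3 → Fin 3 → ℝ) (L : ℕ) (S : ℕ → Fin 3 → Set ℝ) : Prop :=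
  (∀ i, S 0 i = Set.Ici 0) ∧
  ∀ τ, 1 ≤ τ → τ ≤ L → ∃ i : Fin 3,
    (∀ j, j ≠ i → S τ j = S (τ - 1) j) ∧
    S τ i ⊂ S (τ - 1) i ∧
    ∀ s ∈ S (τ - 1) i \ S τ i, ∃ s' ∈ S τ i, WeaklyDominates (utilSP v i) i (S τ) s' s

theorem winnerLow_eq_iff {n : ℕ} (b : Fin (n + 1) → ℝ) (w : Fin (n + 1)) :
    winnerLow b = w ↔ (∀ j, b j ≤ b w) ∧ ∀ i, (∀ j, b j ≤ b i) → w ≤ i := by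
  unfold winnerLow
  rw [Finset.min'_eq_iff]
  simp

theorem winnerLow_fin_three (b : Fin 3 → ℝ) :
    winnerLow b = if b 1 ≤ b 0 ∧ b 2 ≤ b 0 then 0 else if b 2 ≤ b 1 then 1 else 2 := by
  rw [winnerLow_eq_iff]
  split_ifs with h₀ h₁
  · simp [Fin.forall_fin_succ, h₀]
  · have h : b 0 ≤ b 1 ∧ ¬ (b 1 ≤ b 0 ∧ b 2 ≤ b 0) := ⟨by grind, h₀⟩
    simp [Fin.forall_fin_succ, h₁, h]
    grind
  · have h : b 0 ≤ b 2 ∧ b 1 ≤ b 2 := by grind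
    simp [Fin.forall_fin_succ, h]
    grind

theorem secondPrice_fin_three (b : Fin 3 → ℝ) :
    secondPrice b 0 = max (b 1) (b 2) ∧ secondPrice b 1 = max (b 0) (b 2) ∧
      secondPrice b 2 = max (b 0) (b 1) := by
  have h₀ : (Finset.univ.erase (0 : Fin 3)) = {1, 2} := by decide
  have h₁ : (Finset.univ.erase (1 : Fin 3)) = {0, 2} := by decide
  have h₂ : (Finset.univ.erase (2 : Fin 3)) = {0, 1} := by decide
  simp [secondPrice, h₀, h₁, h₂]

theorem utilSP_vA_zero (b : Fin 3 → ℝ) :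
    utilSP vA 0 b = if b 1 ≤ b 0 ∧ b 2 ≤ b 0 then 2 - max (b 1) (b 2)
      else if b 2 ≤ b 1 then 1 else 0 := by
  rw [utilSP, winnerLow_fin_three]
  split_ifs <;> simp_all [vA, secondPrice_fin_three]

theorem utilSP_vA_one (b : Fin 3 → ℝ) :
    utilSP vA 1 b = if b 1 ≤ b 0 ∧ b 2 ≤ b 0 then 0
      else if b 2 ≤ b 1 then 4 - max (b 0) (b 2) else 1 := by
  rw [utilSP, winnerLow_fin_three]
  split_ifs <;> simp_all [vA, secondPrice_fin_three]

theorem utilSP_vA_two (b : Fin 3 → ℝ) :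
    utilSP vA 2 b = if b 1 ≤ b 0 ∧ b 2 ≤ b 0 then 0
      else if b 2 ≤ b 1 then 1 else 6 - max (b 0) (b 1) := by
  rw [utilSP, winnerLow_fin_three]
  split_ifs <;> simp_all [vA, secondPrice_fin_three]

/-- Against unrestricted opponents, Buyer 2's bid `3` weakly dominates every lower bid. -/
theorem weaklyDominates_one_three {S : Fin 3 → Set ℝ} (h₀ : S 0 = Set.Ici 0)
    (h₂ : S 2 = Set.Ici 0) {s : ℝ} (hs : 0 ≤ s) (hs' : s < 3) :
    WeaklyDominates (utilSP vA 1) 1 S 3 s := by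
  refine ⟨fun b _ => ?_, ![0, 0, (s + 3) / 2], ?_, ?_⟩
  · simp [utilSP_vA_one, Function.update_of_ne]
    grind
  · simp [Fin.forall_fin_succ, h₀, h₂]
    linarith
  · simp [utilSP_vA_one, Function.update_of_ne]
    grind

/-- Against unrestricted opponents, Buyer 3's bid `5` weakly dominates every lower bid. -/
theorem weaklyDominates_two_five {S : Fin 3 → Set ℝ} (h₀ : S 0 = Set.Ici 0)
    (h₁ : S 1 = Set.Ici 0) {s : ℝ} (hs : 0 ≤ s) (hs' : s < 5) :
    WeaklyDominates (utilSP vA 2) 2 S 5 s := by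
  refine ⟨fun b _ => ?_, ![0, (s + 5) / 2, 0], ?_, ?_⟩
  · simp [utilSP_vA_two, Function.update_of_ne]
    grind
  · simp [Fin.forall_fin_succ, h₀, h₁]
    linarith
  · simp [utilSP_vA_two, Function.update_of_ne]
    grind

/-- If Buyer 2 never bids in `(0, 3)`, then only Buyer 3 can set a price in `(0, 3)` and Buyer 1's
bid `2` weakly dominates all its other bids. -/
theorem weaklyDominates_zero_two {S : Fin 3 → Set ℝ} (h₁ : S 1 = Set.Ici 0 \ Set.Ioo 0 3)
    (h₂ : S 2 = Set.Ici 0) {s : ℝ} (hs : 0 ≤ s) (hs' : s ≠ 2) :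
    WeaklyDominates (utilSP vA 0) 0 S 2 s := by
  refine ⟨fun b hb => ?_, ![0, 0, (s + 2) / 2], ?_, ?_⟩
  · have hb₁ := hb 1 (by decide)
    have hb₂ := hb 2 (by decide)
    simp [h₁] at hb₁
    simp [h₂] at hb₂
    simp [utilSP_vA_zero, Function.update_of_ne]
    grind
  · simp [Fin.forall_fin_succ, h₁, h₂]
    linarith
  · simp [utilSP_vA_zero, Function.update_of_ne]
    grind

/-- If Buyer 3 never bids in `(0, 5)`, then only Buyer 2 can set a price in `(0, 5)` and Buyer 1's
bid `1` weakly dominates its bid `2`. -/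
theorem weaklyDominates_zero_one {S : Fin 3 → Set ℝ} (h₁ : S 1 = Set.Ici 0)
    (h₂ : S 2 = Set.Ici 0 \ Set.Ioo 0 5) :
    WeaklyDominates (utilSP vA 0) 0 S 1 2 := by
  refine ⟨fun b hb => ?_, ![0, 3 / 2, 0], ?_, ?_⟩
  · have hb₁ := hb 1 (by decide)
    have hb₂ := hb 2 (by decide)
    simp [h₁] at hb₁
    simp [h₂] at hb₂
    simp [utilSP_vA_zero, Function.update_of_ne]
    grind
  · simp [Fin.forall_fin_succ, h₁, h₂]
    norm_num
  · simp [utilSP_vA_zero, Function.update_of_ne]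
    grind

/-- Buyer 1's bid `b` can be deleted in two steps: first buyer `i` deletes the bids in `(0, c)`
because of its bid `c`, then Buyer 1 deletes `b` because of its bid `t`. -/
theorem exists_validSeq_notMem (v : Fin 3 → Fin 3 → ℝ) {i : Fin 3} (hi : i ≠ 0) {b t c : ℝ}
    (hb : 0 ≤ b) (ht : 0 ≤ t) (htb : t ≠ b) (hc : 0 < c)
    (hdom : ∀ S : Fin 3 → Set ℝ, (∀ j, j ≠ i → S j = Set.Ici 0) → ∀ s ∈ Set.Ioo 0 c,
      WeaklyDominates (utilSP v i) i S c s)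
    (hdom' : ∀ S : Fin 3 → Set ℝ, S i = Set.Ici 0 \ Set.Ioo 0 c →
      (∀ j, j ≠ i → j ≠ 0 → S j = Set.Ici 0) → WeaklyDominates (utilSP v 0) 0 S t b) :
    ∃ (L : ℕ) (S : ℕ → Fin 3 → Set ℝ) (τ : ℕ), ValidSeq v L S ∧ τ ≤ L ∧ b ∉ S τ 0 := by
  let S₁ : Fin 3 → Set ℝ := Function.update (fun _ => Set.Ici 0) i (Set.Ici 0 \ Set.Ioo 0 c)
  let S₂ : Fin 3 → Set ℝ := Function.update S₁ 0 (Set.Ici 0 \ {b})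
  have hS₁ : S₁ 0 = Set.Ici 0 := by simp [S₁, hi.symm]
  have hS₁' : S₁ i = Set.Ici 0 \ Set.Ioo 0 c := by simp [S₁]
  have hS₂ : S₂ 0 = Set.Ici 0 \ {b} := by simp [S₂]
  refine ⟨2, fun τ => if τ = 0 then fun _ => Set.Ici 0 else if τ = 1 then S₁ else S₂, 2,
    ⟨by simp, fun τ h h' => ?_⟩, le_rfl, by simp [hS₂]⟩
  obtain rfl | rfl : τ = 1 ∨ τ = 2 := by omega
  · refine ⟨i, fun j hj => by simp [S₁, hj], ?_, fun s hs => ?_⟩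
    · simp only [one_ne_zero, if_false, if_true, Nat.sub_self, hS₁']
      refine ⟨Set.sdiff_subset, fun h => ?_⟩
      exact (h (show c / 2 ∈ Set.Ici 0 from (half_pos hc).le)).2 ⟨half_pos hc, half_lt_self hc⟩
    · simp only [one_ne_zero, if_false, if_true, Nat.sub_self, hS₁', sdiff_sdiff_right_self] at hs ⊢
      exact ⟨c, ⟨hc.le, fun h => lt_irrefl _ h.2⟩, hdom _ (fun j hj => by simp [S₁, hj]) s hs.2⟩
  · refine ⟨0, fun j hj => by simp [S₂, hj], ?_, fun s hs => ?_⟩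
    · simp only [OfNat.ofNat_ne_zero, OfNat.ofNat_ne_one, if_false, Nat.add_one_sub_one,
        one_ne_zero, if_true, hS₁, hS₂]
      exact ⟨Set.sdiff_subset, fun h => (h (show b ∈ Set.Ici 0 from hb)).2 rfl⟩
    · simp only [OfNat.ofNat_ne_zero, OfNat.ofNat_ne_one, if_false, Nat.add_one_sub_one,
        one_ne_zero, if_true, hS₁, hS₂, sdiff_sdiff_right_self] at hs ⊢
      obtain rfl : s = b := hs.2
      exact ⟨t, ⟨ht, htb⟩, hdom' _ (by simp [S₂, S₁, hi]) fun j hj hj' => by simp [S₂, S₁, hj, hj']⟩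

/-- In the specific 3-buyer second-price auction `vA` (ties broken in favor of the lowest
index), no strategy of Buyer 1 (index 0) survives the iterative deletion of weakly
dominated strategies: for every bid `b ∈ [0, ∞)` there is a valid sequence of iterative
deletions and a step `τ` of it at which `b` has been deleted from Buyer 1's set. -/
theorem stmt8 :
    ∀ b : ℝ, 0 ≤ b → ∃ (L : ℕ) (S : ℕ → Fin 3 → Set ℝ) (τ : ℕ),
      ValidSeq vA L S ∧ τ ≤ L ∧ b ∉ S τ 0 := by
  intro b hb
  by_cases h : b = 2
  · subst h
    exact exists_validSeq_notMem vA (i := 2) (t := 1) (c := 5) (by decide) hb (by norm_num)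
      (by norm_num) (by norm_num)
      (fun S hS s hs => weaklyDominates_two_five (hS 0 (by decide)) (hS 1 (by decide)) hs.1.le hs.2)
      (fun S hS hS' => weaklyDominates_zero_one (hS' 1 (by decide) (by decide)) hS)
  · exact exists_validSeq_notMem vA (i := 1) (t := 2) (c := 3) (by decide) hb (by norm_num)
      (Ne.symm h) (by norm_num)
      (fun S hS s hs => weaklyDominates_one_three (hS 0 (by decide)) (hS 2 (by decide)) hs.1.le hs.2)
      (fun S hS hS' => weaklyDominates_zero_two hS (hS' 2 (by decide) (by decide)) hb h)
end

section
/- Consider a two-buyer second-price auction with interdependent valuations v : Fin 2 → Fin 2 → ℝ with ties broken in favor of Buyer 1, and suppose 0 ≤ v 2 2 − v 2 1 ≤ v 1 1 − v 1 2 (so Buyer 2 is the losing buyer with dropout bid β₂ = v 2 2 − v 2 1). Then the set of bids of Buyer 2 that survive the iterative deletion of strategies weakly dominated by a lower bid is exactly the interval [0, β₂]: every bid p > β₂ fails to survive (there is a valid sequence deleting it), and every bid q ∈ [0, β₂] belongs to S_2^τ for every step τ of every valid sequence. -/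
/-- `ValidSeqLower v L S` : `S 0, S 1, …, S L` is a valid sequence for the iterative
deletion of strategies weakly dominated by a lower bid in the two-buyer second-price
auction `v`: both buyers start with `[0, ∞)` and at each step `1 ≤ τ ≤ L` one buyer `i`
has its strategy set strictly shrunk (the other buyer's set is unchanged), where every
deleted bid is weakly dominated, relative to the other buyer's current set, by some
strictly lower surviving bid. -/
def ValidSeqLower (v : Fin 2 → Fin 2 → ℝ) (L : ℕ) (S : ℕ → Fin 2 → Set ℝ) : Prop :=
  (∀ i, S 0 i = Set.Ici 0) ∧
  ∀ τ, 1 ≤ τ → τ ≤ L → ∃ i : Fin 2,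
    (∀ j, j ≠ i → S τ j = S (τ - 1) j) ∧
    S τ i ⊂ S (τ - 1) i ∧
    ∀ s ∈ S (τ - 1) i \ S τ i, ∃ s' ∈ S τ i,
      s' < s ∧ WeaklyDominates (utilSP v i) i (S τ) s' s

theorem le_bid_winnerLow {n : ℕ} (b : Fin (n + 1) → ℝ) (j : Fin (n + 1)) :
    b j ≤ b (winnerLow b) :=
  (Finset.mem_filter.mp (Finset.min'_mem
    (Finset.univ.filter fun i => ∀ j, b j ≤ b i) _)).2 j

theorem winnerLow_le {n : ℕ} {b : Fin (n + 1) → ℝ} {i : Fin (n + 1)} (h : ∀ j, b j ≤ b i) :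
    winnerLow b ≤ i :=
  Finset.min'_le _ _ (Finset.mem_filter.mpr ⟨Finset.mem_univ i, h⟩)

theorem winnerLow_eq_one {b : Fin 2 → ℝ} (h : b 0 < b 1) : winnerLow b = 1 := by
  have h1 := le_bid_winnerLow b 1
  rcases Fin.eq_zero_or_eq_succ (winnerLow b) with h0 | ⟨k, hk⟩
  · rw [h0] at h1
    exact absurd h1 (not_le.mpr h)
  · rw [hk, Subsingleton.elim k 0]
    rfl

theorem winnerLow_eq_zero {b : Fin 2 → ℝ} (h : b 1 ≤ b 0) : winnerLow b = 0 :=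
  Fin.le_zero_iff.mp (winnerLow_le (Fin.forall_fin_two.mpr ⟨le_rfl, h⟩))

theorem secondPrice_one (b : Fin 2 → ℝ) : secondPrice b 1 = b 0 := by
  have h : (Finset.univ : Finset (Fin 2)).erase 1 = {0} := by decide
  simp [secondPrice, h]

/-- Buyer 2 wins exactly when it bids strictly above Buyer 1, and then pays Buyer 1's bid. -/
theorem utilSP_one_update (v : Fin 2 → Fin 2 → ℝ) (b : Fin 2 → ℝ) (s : ℝ) :
    utilSP v 1 (Function.update b 1 s) = if b 0 < s then v 1 1 - b 0 else v 1 0 := by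
  split_ifs with h
  · have hw : winnerLow (Function.update b 1 s) = 1 := winnerLow_eq_one (by simpa using h)
    simp [utilSP, hw, secondPrice_one]
  · have hw : winnerLow (Function.update b 1 s) = 0 := winnerLow_eq_zero (by simpa using h)
    simp [utilSP, hw]

/-- Every bid of Buyer 2 above its dropout bid is weakly dominated by the dropout bid, as soon
as Buyer 1 may bid strictly in between. -/
theorem weaklyDominates_dropout {v : Fin 2 → Fin 2 → ℝ} {S : Fin 2 → Set ℝ} {p c : ℝ}
    (hc : c ∈ S 0) (hβc : v 1 1 - v 1 0 < c) (hcp : c < p) :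
    WeaklyDominates (utilSP v 1) 1 S (v 1 1 - v 1 0) p := by
  constructor
  · intro b _
    rw [utilSP_one_update, utilSP_one_update]
    split_ifs <;> linarith
  · refine ⟨fun _ => c, Fin.forall_fin_two.mpr ⟨fun _ => hc, fun h => absurd rfl h⟩, ?_⟩
    rw [utilSP_one_update, utilSP_one_update, if_pos hcp, if_neg hβc.not_gt]
    linarith

/-- No bid of Buyer 2 up to its dropout bid is weakly dominated by a lower bid. -/
theorem not_weaklyDominates_of_le_dropout {v : Fin 2 → Fin 2 → ℝ} {S : Fin 2 → Set ℝ}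
    {q s : ℝ} (hq : q ≤ v 1 1 - v 1 0) (hs : s < q) :
    ¬ WeaklyDominates (utilSP v 1) 1 S s q := by
  rintro ⟨-, b, -, hlt⟩
  rw [utilSP_one_update, utilSP_one_update] at hlt
  split_ifs at hlt <;> linarith

/-- In a two-buyer second-price auction with interdependent valuations (Buyer 1 is
index 0, Buyer 2 is index 1, ties broken in favor of Buyer 1), if
`0 ≤ β₂ = v 1 1 - v 1 0 ≤ v 0 0 - v 0 1`, then the set of bids of Buyer 2 surviving the
iterative deletion of strategies weakly dominated by a lower bid is exactly `[0, β₂]`: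
every bid `p > β₂` is deleted by some valid sequence, while every bid `q ∈ [0, β₂]`
survives every step of every valid sequence. -/
theorem stmt12 (v : Fin 2 → Fin 2 → ℝ)
    (hβ0 : 0 ≤ v 1 1 - v 1 0) (hβ : v 1 1 - v 1 0 ≤ v 0 0 - v 0 1) :
    (∀ p : ℝ, v 1 1 - v 1 0 < p →
      ∃ (L : ℕ) (S : ℕ → Fin 2 → Set ℝ) (τ : ℕ),
        ValidSeqLower v L S ∧ τ ≤ L ∧ p ∉ S τ 1) ∧
    (∀ q ∈ Set.Icc (0 : ℝ) (v 1 1 - v 1 0),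
      ∀ (L : ℕ) (S : ℕ → Fin 2 → Set ℝ), ValidSeqLower v L S →
        ∀ τ ≤ L, q ∈ S τ 1) := by
  constructor
  · intro p hp
    refine ⟨1, fun τ => if τ = 0 then fun _ => Set.Ici 0 else
      Function.update (fun _ => Set.Ici 0) 1 (Set.Ici 0 \ {p}), 1, ⟨fun i => by simp, ?_⟩,
      le_rfl, by simp⟩
    intro τ h1 hL
    obtain rfl : τ = 1 := le_antisymm hL h1
    refine ⟨1, fun j hj => by simp [hj], ?_, ?_⟩
    · simpa using hβ0.trans hp.le
    · intro s hs
      obtain rfl : s = p := by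
        by_contra hne
        simp_all
      obtain ⟨c, hβc, hcp⟩ := exists_between hp
      refine ⟨v 1 1 - v 1 0, ?_, hp, weaklyDominates_dropout (c := c) ?_ hβc hcp⟩
      · simpa using ⟨sub_nonneg.mp hβ0, hp.ne⟩
      · simpa using hβ0.trans hβc.le
  · rintro q ⟨hq0, hqβ⟩ L S ⟨h0, hstep⟩ τ
    induction τ with
    | zero =>
      intro _
      rw [h0]
      exact hq0
    | succ k ih =>
      intro hk
      have hmem : q ∈ S k 1 := ih (by omega)
      obtain ⟨i, hkeep, -, hdel⟩ := hstep (k + 1) (by omega) hk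
      rw [Nat.add_sub_cancel] at hkeep hdel
      by_cases hi : (1 : Fin 2) = i
      · subst hi
        by_contra hnot
        obtain ⟨s, -, hsq, hdom⟩ := hdel q ⟨hmem, hnot⟩
        exact not_weaklyDominates_of_le_dropout hqβ hsq hdom
      · rwa [hkeep 1 hi]
end
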